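/- arXiv:2007.07108 — 4 statements merged into one kernel-verified Lean document; each statement's English description precedes it below -/
import Mathlib

section
/- Let T > 0, let N : [0,T] → ℝ be continuous with N(t) > 0 for all t, and let p, q : [0,T] → ℝ^k be differentiable with p′(t) = N(t)·q(t) and q′(t) = 2·N(t)·p(t) for all t ∈ [0,T]. If p(0) = 0 and p(T) = 0, then p(t) = 0 and q(t) = 0 for all t ∈ [0,T]. (Since the Legendrian Λ ∩ H₊ lies in {p = 0}, this shows that any Reeb chord of Λ ∩ H₊, i.e. any Reeb trajectory with p vanishing at both endpoints, is entirely contained in the slice p = q = 0: the Reeb flow is hyperbolic in the (p,q)-plane.) -/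
open Set in
/-- A solution of `p' = N * q`, `q' = 2 * N * p` on `[0, T]` with `N > 0` and `p` vanishing at both
endpoints is zero, because `p * q` has derivative `N * (q ^ 2 + 2 * p ^ 2) ≥ 0`. -/
theorem eq_zero_of_hyperbolic_system {T : ℝ} (hT : 0 < T) {N p q : ℝ → ℝ}
    (hN : ∀ t ∈ Icc 0 T, 0 < N t)
    (hp : ∀ t ∈ Icc 0 T, HasDerivWithinAt p (N t * q t) (Icc 0 T) t)
    (hq : ∀ t ∈ Icc 0 T, HasDerivWithinAt q (2 * N t * p t) (Icc 0 T) t)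
    (hp0 : p 0 = 0) (hpT : p T = 0) {t : ℝ} (ht : t ∈ Icc 0 T) : p t = 0 ∧ q t = 0 := by
  have hd : ∀ s ∈ Icc 0 T, HasDerivWithinAt (fun s => p s * q s)
      (N s * (q s ^ 2 + 2 * p s ^ 2)) (Icc 0 T) s := fun s hs =>
    ((hp s hs).mul (hq s hs)).congr_deriv (by ring)
  have hmono : MonotoneOn (fun s => p s * q s) (Icc 0 T) :=
    monotoneOn_of_hasDerivWithinAt_nonneg (convex_Icc 0 T)
      (fun s hs => (hd s hs).continuousWithinAt)
      (fun s hs => (hd s (interior_subset hs)).mono interior_subset)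
      (fun s hs => mul_nonneg (hN s (interior_subset hs)).le (by positivity))
  have hzero : ∀ s ∈ Icc 0 T, p s * q s = 0 := fun s hs => by
    have h₀ := hmono (left_mem_Icc.2 hT.le) hs hs.1
    have h₁ := hmono hs (right_mem_Icc.2 hT.le) hs.2
    simp only [hp0, hpT, zero_mul] at h₀ h₁
    exact le_antisymm h₁ h₀
  have hderiv : N t * (q t ^ 2 + 2 * p t ^ 2) = 0 :=
    (uniqueDiffOn_Icc hT t ht).eq_deriv _ (hd t ht)
      ((hasDerivWithinAt_const t (Icc 0 T) (0 : ℝ)).congr hzero (hzero t ht))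
  have hsum := (mul_eq_zero.1 hderiv).resolve_left (hN t ht).ne'
  constructor <;> refine pow_eq_zero_iff two_ne_zero |>.1 ?_ <;>
    nlinarith [sq_nonneg (p t), sq_nonneg (q t)]

/-- Hyperbolicity of the Reeb flow in the `(p,q)`-plane: if `N` is continuous and positive on
`[0,T]`, `p′ = N·q` and `q′ = 2N·p` on `[0,T]`, and `p` vanishes at both endpoints `0` and `T`,
then `p ≡ 0` and `q ≡ 0` on `[0,T]`. (Key step of Lemmas 4.2 and 4.5: any Reeb chord of
`Λ ∩ H₊ ⊂ {p = 0}` is entirely contained in the slice `p = q = 0`.) -/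
theorem reeb_chord_in_slice (k : ℕ) (hk : 1 ≤ k) (T : ℝ) (hT : 0 < T)
    (N : ℝ → ℝ) (hNcont : ContinuousOn N (Set.Icc 0 T))
    (hNpos : ∀ t ∈ Set.Icc (0 : ℝ) T, 0 < N t)
    (p q : ℝ → Fin k → ℝ)
    (hp : ∀ (i : Fin k), ∀ t ∈ Set.Icc (0 : ℝ) T,
      HasDerivWithinAt (fun s => p s i) (N t * q t i) (Set.Icc 0 T) t)
    (hq : ∀ (i : Fin k), ∀ t ∈ Set.Icc (0 : ℝ) T,
      HasDerivWithinAt (fun s => q s i) (2 * N t * p t i) (Set.Icc 0 T) t)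
    (hp0 : p 0 = 0) (hpT : p T = 0) :
    ∀ t ∈ Set.Icc (0 : ℝ) T, p t = 0 ∧ q t = 0 := by
  intro t ht
  have h := fun i => eq_zero_of_hyperbolic_system hT hNpos (hp i) (hq i)
    (congrFun hp0 i) (congrFun hpT i) ht
  exact ⟨funext fun i => (h i).1, funext fun i => (h i).2⟩
end

section
/- Let δ > 0 and let 0 < q₁ < q₂ be real numbers. If T₁, T₂ ∈ ℝ satisfy e^{−T₁}(δ² + q₁²) = e^{2T₁}q₁² − δ² and e^{−T₂}(δ² + q₂²) = e^{2T₂}q₂² − δ², then T₁ > T₂. That is, the flow time T(q) strictly decreases as q increases (equivalently, e^{−T(q)} strictly increases with q). -/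
/-- Monotonicity part of Lemma 4.1: if `0 < q₁ < q₂` and `T₁, T₂` solve the flow-time
equations `e^{−Tᵢ}(δ² + qᵢ²) = e^{2Tᵢ}qᵢ² − δ²`, then `T₁ > T₂`: the flow time `T(q)`
strictly decreases as `q` increases (equivalently `e^{−T(q)}` strictly increases with `q`). -/
theorem flow_time_strict_anti (δ q₁ q₂ T₁ T₂ : ℝ) (hδ : 0 < δ)
    (hq₁ : 0 < q₁) (hq₁₂ : q₁ < q₂)
    (h₁ : Real.exp (-T₁) * (δ ^ 2 + q₁ ^ 2) = Real.exp (2 * T₁) * q₁ ^ 2 - δ ^ 2)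
    (h₂ : Real.exp (-T₂) * (δ ^ 2 + q₂ ^ 2) = Real.exp (2 * T₂) * q₂ ^ 2 - δ ^ 2) :
    T₂ < T₁ := by
  by_contra! hT
  have hexp_neg : Real.exp (-T₂) ≤ Real.exp (-T₁) := Real.exp_le_exp.2 (by linarith)
  have hexp_two : Real.exp (2 * T₁) ≤ Real.exp (2 * T₂) := Real.exp_le_exp.2 (by linarith)
  have hsq : q₁ ^ 2 < q₂ ^ 2 := by gcongr
  have hgap : 0 < Real.exp (2 * T₁) - Real.exp (-T₁) := by
    refine pos_of_mul_pos_right (a := q₁ ^ 2) ?_ (sq_nonneg q₁)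
    have : 0 < δ ^ 2 * (1 + Real.exp (-T₁)) := by positivity
    linarith
  have : q₁ ^ 2 * (Real.exp (2 * T₁) - Real.exp (-T₁)) <
      q₁ ^ 2 * (Real.exp (2 * T₁) - Real.exp (-T₁)) :=
    calc q₁ ^ 2 * (Real.exp (2 * T₁) - Real.exp (-T₁))
      _ < q₂ ^ 2 * (Real.exp (2 * T₁) - Real.exp (-T₁)) := by gcongr
      _ ≤ q₂ ^ 2 * (Real.exp (2 * T₂) - Real.exp (-T₂)) := by gcongr
      _ = δ ^ 2 * (1 + Real.exp (-T₂)) := by linarith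
      _ ≤ δ ^ 2 * (1 + Real.exp (-T₁)) := by gcongr
      _ = q₁ ^ 2 * (Real.exp (2 * T₁) - Real.exp (-T₁)) := by linarith
  exact this.false
end

section
/- Fix integers n > k ≥ 1, positive reals a₁,…,a_{n−k}, and δ > 0. Let x ∈ ℝ^{n−k} and q ∈ ℝ^k with q ≠ 0 satisfy Σⱼ(aⱼ/2)xⱼ² = δ² + |q|² (so that the point (x,0,0,q) lies on the standard Legendrian cylinder Λ_st ⊂ H₊ = {Φ = δ²}). Then there exists a unique T ∈ ℝ such that the backward Liouville-flowed point (e^{−T/2}·x, 0, 0, e^{T}·q) lies on H₋ = {Φ = −δ²}; this T is strictly positive, depends only on |q| (not on x or the direction of q), and strictly decreases as |q| increases: if (x,0,0,q) and (x′,0,0,q′) are two such points with |q| < |q′| and flow times T, T′, then T > T′. -/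
/-- A point/vector of the model handle `ℝ^{n-k} × ℝ^{n-k} × ℝ^k × ℝ^k` (here `m = n - k`). -/
abbrev HdlPt (m k : ℕ) := (Fin m → ℝ) × (Fin m → ℝ) × (Fin k → ℝ) × (Fin k → ℝ)

/-- `Φ(x,y,p,q) = Σⱼ (aⱼ/2)(xⱼ²+yⱼ²) + Σᵢ (2pᵢ² − qᵢ²)`. -/
noncomputable def hdlPhi (m k : ℕ) (a : Fin m → ℝ) (z : HdlPt m k) : ℝ :=
  ∑ j, (a j / 2) * (z.1 j ^ 2 + z.2.1 j ^ 2) + ∑ i, (2 * z.2.2.1 i ^ 2 - z.2.2.2 i ^ 2)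

/-- `Φ` along the backward flow line of a point of `Λ_st`, with `S = |q|²` and `D = δ²`. -/
noncomputable def flowPhi (D S T : ℝ) : ℝ := Real.exp (-T) * (D + S) - Real.exp (2 * T) * S

theorem hdlPhi_flow {m k : ℕ} (a x : Fin m → ℝ) (q : Fin k → ℝ) (D T : ℝ)
    (hx : ∑ j, (a j / 2) * x j ^ 2 = D + ∑ i, q i ^ 2) :
    hdlPhi m k a (fun j => Real.exp (-T / 2) * x j, 0, 0, fun i => Real.exp T * q i)
      = flowPhi D (∑ i, q i ^ 2) T := by
  have h₁ : Real.exp (-T / 2) ^ 2 = Real.exp (-T) := by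
    rw [← Real.exp_nat_mul]
    congr 1
    push_cast
    ring
  have h₂ : Real.exp T ^ 2 = Real.exp (2 * T) := by
    rw [← Real.exp_nat_mul]
    norm_cast
  rw [flowPhi, ← hx, hdlPhi, Finset.mul_sum, Finset.mul_sum, sub_eq_add_neg,
    ← Finset.sum_neg_distrib]
  congr 1
  · refine Finset.sum_congr rfl fun j _ => ?_
    simp only [Pi.zero_apply, mul_pow, h₁]
    ring
  · refine Finset.sum_congr rfl fun i _ => ?_
    simp only [Pi.zero_apply, mul_pow, h₂]
    ring

theorem sum_sq_pos_of_ne_zero {k : ℕ} {q : Fin k → ℝ} (hq : q ≠ 0) : 0 < ∑ i, q i ^ 2 := by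
  obtain ⟨i, hi⟩ := Function.ne_iff.mp hq
  exact Finset.sum_pos' (fun i _ => sq_nonneg _) ⟨i, Finset.mem_univ i, sq_pos_of_ne_zero hi⟩

theorem flowPhi_strictAnti {D S : ℝ} (hD : 0 < D) (hS : 0 < S) : StrictAnti (flowPhi D S) := by
  intro T T' h
  have h₁ : Real.exp (-T') < Real.exp (-T) := Real.exp_lt_exp.mpr (by linarith)
  have h₂ : Real.exp (2 * T) < Real.exp (2 * T') := Real.exp_lt_exp.mpr (by linarith)
  exact sub_lt_sub (mul_lt_mul_of_pos_right h₁ (by positivity)) (mul_lt_mul_of_pos_right h₂ hS)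

theorem flowPhi_zero (D S : ℝ) : flowPhi D S 0 = D := by
  simp [flowPhi]

theorem flowPhi_lt_of_lt {D S S' T : ℝ} (hT : 0 < T) (h : S < S') :
    flowPhi D S' T < flowPhi D S T := by
  have h₁ : Real.exp (-T) < Real.exp (2 * T) := Real.exp_lt_exp.mpr (by linarith)
  have h₂ := mul_lt_mul_of_pos_right h₁ (sub_pos.mpr h)
  unfold flowPhi
  linarith

theorem exists_flowPhi_eq_neg {D S : ℝ} (hD : 0 < D) (hS : 0 < S) :
    ∃ T, flowPhi D S T = -D := by
  set R := Real.log ((2 * D + S) / S) / 2 with hR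
  have hR₀ : 0 ≤ R := by
    have : 1 ≤ (2 * D + S) / S := by
      rw [le_div_iff₀ hS]
      linarith
    have := Real.log_nonneg this
    positivity
  have hexp : Real.exp (2 * R) * S = 2 * D + S := by
    rw [hR, mul_div_cancel₀ _ two_ne_zero, Real.exp_log (by positivity),
      div_mul_cancel₀ _ hS.ne']
  have hle : flowPhi D S R ≤ -D := by
    have h₁ : Real.exp (-R) ≤ 1 := Real.exp_le_one_iff.mpr (by linarith)
    have h₂ := mul_le_mul_of_nonneg_right h₁ (by positivity : 0 ≤ D + S)
    rw [flowPhi, hexp]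
    linarith
  have hcont : Continuous (flowPhi D S) := by
    unfold flowPhi
    fun_prop
  exact mem_range_of_exists_le_of_exists_ge hcont ⟨R, hle⟩
    ⟨0, by rw [flowPhi_zero]; linarith⟩

theorem pos_of_flowPhi_eq_neg {D S T : ℝ} (hD : 0 < D) (hS : 0 < S)
    (hT : flowPhi D S T = -D) : 0 < T := by
  rw [← (flowPhi_strictAnti hD hS).lt_iff_gt, hT, flowPhi_zero]
  linarith

/-- Lemma 4.1 in geometric form. Let `(x,0,0,q)` with `q ≠ 0` lie on the standard Legendrian
cylinder `Λ_st ⊂ H₊ = {Φ = δ²}`, i.e. `Σⱼ(aⱼ/2)xⱼ² = δ² + |q|²`. Then there is a unique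
`T ∈ ℝ` such that the backward Liouville-flowed point `(e^{−T/2}x, 0, 0, e^{T}q)` lies on
`H₋ = {Φ = −δ²}`; this `T` is strictly positive, depends only on `|q|`, and strictly
decreases as `|q|` increases. -/
theorem liouville_flow_time_from_legendrian_cylinder (n k : ℕ) (hk : 1 ≤ k) (hkn : k < n)
    (a : Fin (n - k) → ℝ) (ha : ∀ j, 0 < a j) (δ : ℝ) (hδ : 0 < δ)
    (x x' : Fin (n - k) → ℝ) (q q' : Fin k → ℝ) (hq : q ≠ 0) (hq' : q' ≠ 0)
    (hx : ∑ j, (a j / 2) * x j ^ 2 = δ ^ 2 + ∑ i, q i ^ 2)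
    (hx' : ∑ j, (a j / 2) * x' j ^ 2 = δ ^ 2 + ∑ i, q' i ^ 2) :
    (∃! T : ℝ,
      hdlPhi (n - k) k a
        (fun j => Real.exp (-T / 2) * x j, 0, 0, fun i => Real.exp T * q i) = -δ ^ 2)
    ∧ (∀ T T' : ℝ,
        hdlPhi (n - k) k a
            (fun j => Real.exp (-T / 2) * x j, 0, 0, fun i => Real.exp T * q i) = -δ ^ 2 →
        hdlPhi (n - k) k a
            (fun j => Real.exp (-T' / 2) * x' j, 0, 0, fun i => Real.exp T' * q' i)
          = -δ ^ 2 →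
        0 < T
        ∧ (∑ i, q i ^ 2 = ∑ i, q' i ^ 2 → T = T')
        ∧ (∑ i, q i ^ 2 < ∑ i, q' i ^ 2 → T' < T)) := by
  have hD : 0 < δ ^ 2 := by positivity
  have hS := sum_sq_pos_of_ne_zero hq
  have hS' := sum_sq_pos_of_ne_zero hq'
  simp only [hdlPhi_flow a x q _ _ hx, hdlPhi_flow a x' q' _ _ hx']
  have hanti := flowPhi_strictAnti hD hS
  refine ⟨?_, fun T T' hT hT' => ⟨pos_of_flowPhi_eq_neg hD hS hT, fun h => ?_, fun h => ?_⟩⟩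
  · obtain ⟨T, hT⟩ := exists_flowPhi_eq_neg hD hS
    exact ⟨T, hT, fun T' hT' => hanti.injective (hT'.trans hT.symm)⟩
  · rw [← h] at hT'
    exact hanti.injective (hT.trans hT'.symm)
  · rw [← hanti.lt_iff_gt, hT, ← hT']
    exact flowPhi_lt_of_lt (pos_of_flowPhi_eq_neg hD hS' hT') h
end

section
/- Fix integers n > k ≥ 1 and define G : ℝ^{n-k} × ℝ^{n-k} × ℝ^k × ℝ^k → ℝ^k × ℝ^k × ℝ^{n-k} × ℝ^{n-k} × ℝ by G(x,y,p,q) = (q, ⟨p,q⟩·q − p, x, y, ⟨p,q⟩ + ½⟨x,y⟩), with target coordinates (u,v,s,t,r) and contact form α_N given at (u,v,s,t,r) on a vector (μ,ν,σ,τ,ρ) by ρ − ⟨v,μ⟩ − ⟨t,σ⟩. Then G is differentiable, and at every point (x,y,p,q) with ⟨p,q⟩ = 0 and for every vector (ξ,η,π,κ), the value of α_N at G(x,y,p,q) on the image of (ξ,η,π,κ) under the Fréchet derivative of G at (x,y,p,q) equals ½(⟨x,η⟩ − ⟨y,ξ⟩) + 2⟨p,κ⟩ + ⟨q,π⟩,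 i.e. it equals the contact form α of the handle evaluated at (x,y,p,q) on (ξ,η,π,κ). In other words, G satisfies G*α_N = α on the locus {⟨p,q⟩ = 0}. -/
/-- The Leibniz rule for the standard dot product of two vector-valued functions. -/
theorem HasFDerivAt.sum_mul_pi {E ι : Type*} [NormedAddCommGroup E] [NormedSpace ℝ E]
    [Fintype ι] {f g : E → ι → ℝ} {f' g' : E →L[ℝ] ι → ℝ} {x : E}
    (hf : HasFDerivAt f f' x) (hg : HasFDerivAt g g' x) :
    HasFDerivAt (fun z => ∑ i, f z i * g z i)
      (∑ i, (f x i • (ContinuousLinearMap.proj i).comp g'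
        + g x i • (ContinuousLinearMap.proj i).comp f')) x :=
  HasFDerivAt.fun_sum fun i _ => (hasFDerivAt_pi'.1 hf i).mul (hasFDerivAt_pi'.1 hg i)


/-- The paper's attaching map for an index-`k` handle (Section 4.3):
`G(x,y,p,q) = (q, ⟨p,q⟩q − p, x, y, ⟨p,q⟩ + ½⟨x,y⟩)` with target coordinates `(u,v,s,t,r)`
and contact form `α_N(μ,ν,σ,τ,ρ) = ρ − ⟨v,μ⟩ − ⟨t,σ⟩` at `(u,v,s,t,r)`. Then `G` is
differentiable and, at every point with `⟨p,q⟩ = 0` and for every tangent vector `(ξ,η,π,κ)`,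
the pullback of `α_N` by `G` equals the handle contact form
`α(ξ,η,π,κ) = ½(⟨x,η⟩ − ⟨y,ξ⟩) + 2⟨p,κ⟩ + ⟨q,π⟩`; i.e. `G*α_N = α` on `{⟨p,q⟩ = 0}`. -/
theorem handle_attaching_map_pullback (n k : ℕ) (hk : 1 ≤ k) (hkn : k < n) :
    letI G : (Fin (n - k) → ℝ) × (Fin (n - k) → ℝ) × (Fin k → ℝ) × (Fin k → ℝ) →
        (Fin k → ℝ) × (Fin k → ℝ) × (Fin (n - k) → ℝ) × (Fin (n - k) → ℝ) × ℝ :=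
      fun z =>
        (z.2.2.2,
         fun i => (∑ i', z.2.2.1 i' * z.2.2.2 i') * z.2.2.2 i - z.2.2.1 i,
         z.1, z.2.1,
         (∑ i, z.2.2.1 i * z.2.2.2 i) + (1 / 2 : ℝ) * ∑ j, z.1 j * z.2.1 j)
    Differentiable ℝ G
    ∧ ∀ z V : (Fin (n - k) → ℝ) × (Fin (n - k) → ℝ) × (Fin k → ℝ) × (Fin k → ℝ),
        ∑ i, z.2.2.1 i * z.2.2.2 i = 0 →
        (fderiv ℝ G z V).2.2.2.2
            - ∑ i, (G z).2.1 i * (fderiv ℝ G z V).1 i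
            - ∑ j, (G z).2.2.2.1 j * (fderiv ℝ G z V).2.2.1 j
          = (1 / 2 : ℝ) * (∑ j, z.1 j * V.2.1 j - ∑ j, z.2.1 j * V.1 j)
            + 2 * ∑ i, z.2.2.1 i * V.2.2.2 i + ∑ i, z.2.2.2 i * V.2.2.1 i := by
  set G : (Fin (n - k) → ℝ) × (Fin (n - k) → ℝ) × (Fin k → ℝ) × (Fin k → ℝ) →
      (Fin k → ℝ) × (Fin k → ℝ) × (Fin (n - k) → ℝ) × (Fin (n - k) → ℝ) × ℝ :=
    fun z =>
      (z.2.2.2,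
       fun i => (∑ i', z.2.2.1 i' * z.2.2.2 i') * z.2.2.2 i - z.2.2.1 i,
       z.1, z.2.1,
       (∑ i, z.2.2.1 i * z.2.2.2 i) + (1 / 2 : ℝ) * ∑ j, z.1 j * z.2.1 j) with hGdef
  have hG : Differentiable ℝ G := by
    rw [hGdef]
    fun_prop
  refine ⟨hG, fun z V hz => ?_⟩
  have hL := (hG z).hasFDerivAt
  have hid := hasFDerivAt_id (𝕜 := ℝ) z
  have hu : (fderiv ℝ G z V).1 = V.2.2.2 :=
    congrArg (fun L => L V) (hL.fst.unique hid.snd.snd.snd)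
  have hs : (fderiv ℝ G z V).2.2.1 = V.1 :=
    congrArg (fun L => L V) (hL.snd.snd.fst.unique hid.fst)
  have hr : (fderiv ℝ G z V).2.2.2.2
      = ∑ i, (z.2.2.1 i * V.2.2.2 i + z.2.2.2 i * V.2.2.1 i)
        + (1 / 2 : ℝ) * ∑ j, (z.1 j * V.2.1 j + z.2.1 j * V.1 j) := by
    have h := congrArg (fun L => L V) (hL.snd.snd.snd.snd.unique
      ((hid.snd.snd.fst.sum_mul_pi hid.snd.snd.snd).add
        ((hid.fst.sum_mul_pi hid.snd.fst).const_mul (1 / 2 : ℝ))))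
    simpa using h
  rw [hu, hs, hr]
  simp only [hGdef, hz, zero_mul, zero_sub, neg_mul, Finset.sum_neg_distrib, Finset.sum_add_distrib]
  ring
end
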